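/- The entropy functional is monotone with respect to degradation and bounded on symmetric probability measures: if x1, x2 ∈ X satisfy x1 ≻ x2, then H(x1) > H(x2); moreover, 0 ≤ H(x) ≤ 1 for every x ∈ X. -/

import Mathlib

open MeasureTheory Real Filter Topology Polynomial

noncomputable section

/-- The space of finite signed Borel measures on the extended reals `ℝ̄`. -/
abbrev SM := MeasureTheory.SignedMeasure EReal

namespace SCLDPC

/-- The weight `e^{-α/2}` as an extended nonnegative real (`+∞` at `α = -∞`). -/
def wt (α : EReal) : ENNReal :=
  if α = ⊥ then ⊤ else if α = ⊤ then 0 else ENNReal.ofReal (Real.exp (-(α.toReal) / 2))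

/-- A (nonnegative) Borel measure `μ` on `ℝ̄` is symmetric if
`∫_{-E} e^{-α/2} μ(dα) = ∫_{E} e^{-α/2} μ(dα)` for every Borel set `E`
(stated with extended nonnegative integrals, which is equivalent to requiring
equality whenever one of the two sides is finite). -/
def IsSymmMeasure (μ : Measure EReal) : Prop :=
  ∀ E : Set EReal, MeasurableSet E →
    ∫⁻ α in (fun a : EReal => -a) ⁻¹' E, wt α ∂μ = ∫⁻ α in E, wt α ∂μ

/-- Positive part of the Jordan decomposition. -/
def jp (x : SM) : Measure EReal := x.toJordanDecomposition.posPart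

/-- Negative part of the Jordan decomposition. -/
def jn (x : SM) : Measure EReal := x.toJordanDecomposition.negPart

instance (x : SM) : IsFiniteMeasure (jp x) := x.toJordanDecomposition.posPart_finite

instance (x : SM) : IsFiniteMeasure (jn x) := x.toJordanDecomposition.negPart_finite

/-- A finite signed Borel measure on `ℝ̄` is symmetric iff both parts of its Jordan
decomposition are symmetric measures. -/
def IsSymm (x : SM) : Prop := IsSymmMeasure (jp x) ∧ IsSymmMeasure (jn x)

/-- Membership in `X`, the set of symmetric probability measures on `ℝ̄`. -/
def MemX (x : SM) : Prop :=
  (∃ (μ : Measure EReal) (hμ : IsProbabilityMeasure μ),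
      x = (letI := hμ; μ.toSignedMeasure)) ∧ IsSymm x

/-- Membership in `X_d`, the set of differences of symmetric probability measures. -/
def MemXd (y : SM) : Prop := ∃ x1 x2 : SM, MemX x1 ∧ MemX x2 ∧ y = x1 - x2

/-- Integral of a real function against a finite signed measure. -/
def sInt (f : EReal → ℝ) (x : SM) : ℝ := (∫ α, f α ∂(jp x)) - ∫ α, f α ∂(jn x)

/-- `tanh(α/2)` extended continuously to `ℝ̄`. -/
def tanhHalf (α : EReal) : ℝ :=
  if α = ⊤ then 1 else if α = ⊥ then -1 else Real.tanh (α.toReal / 2)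

/-- The inverse hyperbolic tangent on `(-1, 1)`. -/
def artanh (t : ℝ) : ℝ := Real.log ((1 + t) / (1 - t)) / 2

/-- `2 tanh⁻¹(t)` valued in `ℝ̄` (sending `t ≥ 1` to `+∞` and `t ≤ -1` to `-∞`). -/
def atanhTwo (t : ℝ) : EReal :=
  if 1 ≤ t then ⊤ else if t ≤ -1 then ⊥ else ((2 * artanh t : ℝ) : EReal)

/-- Variable-node convolution `⊛` of two (nonnegative) measures:
`(μ ⊛ ν)(E) = ∫ μ(E - α) ν(dα)`, i.e. the pushforward of `μ × ν` under addition. -/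
def mConv (μ ν : Measure EReal) : Measure EReal :=
  (μ.prod ν).map fun p => p.1 + p.2

/-- Check-node convolution `⊠` of two (nonnegative) measures:
`(μ ⊠ ν)(E) = ∫ μ(2 tanh⁻¹(tanh(E/2) / tanh(α/2))) ν(dα)`, where the argument of `μ`
is the image of `E` under `β ↦ 2 tanh⁻¹(tanh(β/2) / tanh(α/2))`; equivalently, the
pushforward of `μ × ν` under `(β, α) ↦ 2 tanh⁻¹(tanh(β/2) · tanh(α/2))`. -/
def mCheck (μ ν : Measure EReal) : Measure EReal :=
  (μ.prod ν).map fun p => atanhTwo (tanhHalf p.1 * tanhHalf p.2)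

instance (μ ν : Measure EReal) [IsFiniteMeasure μ] [IsFiniteMeasure ν] :
    IsFiniteMeasure (mConv μ ν) := by unfold mConv; infer_instance

instance (μ ν : Measure EReal) [IsFiniteMeasure μ] [IsFiniteMeasure ν] :
    IsFiniteMeasure (mCheck μ ν) := by unfold mCheck; infer_instance

/-- The variable-node operation `⊛` extended bilinearly to finite signed measures. -/
def sConv (x y : SM) : SM :=
  (mConv (jp x) (jp y)).toSignedMeasure - (mConv (jp x) (jn y)).toSignedMeasure
    - (mConv (jn x) (jp y)).toSignedMeasure + (mConv (jn x) (jn y)).toSignedMeasure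

/-- The check-node operation `⊠` extended bilinearly to finite signed measures. -/
def sCheck (x y : SM) : SM :=
  (mCheck (jp x) (jp y)).toSignedMeasure - (mCheck (jp x) (jn y)).toSignedMeasure
    - (mCheck (jn x) (jp y)).toSignedMeasure + (mCheck (jn x) (jn y)).toSignedMeasure

/-- The integrand `log₂(1 + e^{-α})` of the entropy functional (with the harmless
convention that it vanishes at `α = ±∞`; symmetric measures put no mass at `-∞`). -/
def entFn (α : EReal) : ℝ :=
  if α = ⊤ then 0 else if α = ⊥ then 0 else Real.logb 2 (1 + Real.exp (-(α.toReal)))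

/-- The entropy functional `H(x) = ∫ log₂(1 + e^{-α}) x(dα)`. -/
def H (x : SM) : ℝ := sInt entFn x

/-- `I_f(x) = ∫ f(|tanh(α/2)|) x(dα)`. -/
def If (f : ℝ → ℝ) (x : SM) : ℝ := sInt (fun α => f |tanhHalf α|) x

/-- `x1` is degraded with respect to `x2` (written `x1 ⪰ x2`): `I_f(x1) ≥ I_f(x2)` for
every concave non-increasing `f : [0,1] → ℝ`. -/
def Degraded (x1 x2 : SM) : Prop :=
  ∀ f : ℝ → ℝ, ConcaveOn ℝ (Set.Icc (0 : ℝ) 1) f → AntitoneOn f (Set.Icc (0 : ℝ) 1) →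
    If f x2 ≤ If f x1

/-- `x1` is strictly degraded with respect to `x2` (written `x1 ≻ x2`). -/
def StrictlyDegraded (x1 x2 : SM) : Prop :=
  Degraded x1 x2 ∧ ∃ f : ℝ → ℝ, ConcaveOn ℝ (Set.Icc (0 : ℝ) 1) f ∧
    AntitoneOn f (Set.Icc (0 : ℝ) 1) ∧ If f x2 < If f x1

lemma jp_jn_of_memX {x : SM} (hx : MemX x) :
    IsProbabilityMeasure (jp x) ∧ jn x = 0 ∧ IsSymmMeasure (jp x) := by
  obtain ⟨⟨μ, hμ, hxμ⟩, hs, -⟩ := hx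
  have key : x.toJordanDecomposition =
      { posPart := μ, negPart := 0,
        mutuallySingular := Measure.MutuallySingular.zero_right } := by
    apply SignedMeasure.toJordanDecomposition_eq
    rw [hxμ]
    ext i hi
    simp [JordanDecomposition.toSignedMeasure]
  have h1 : jp x = μ := by simp [jp, key]
  have h2 : jn x = 0 := by simp [jn, key]
  exact ⟨h1 ▸ hμ, h2, hs⟩

lemma measurable_tanhHalf : Measurable tanhHalf := by
  unfold tanhHalf
  refine Measurable.ite (measurableSet_singleton _) measurable_const ?_
  refine Measurable.ite (measurableSet_singleton _) measurable_const ?_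
  have : Continuous Real.tanh := by
    have : Real.tanh = fun x => Real.sinh x / Real.cosh x := by
      ext x; exact Real.tanh_eq_sinh_div_cosh x
    rw [this]
    exact Real.continuous_sinh.div Real.continuous_cosh (fun x => (Real.cosh_pos x).ne')
  exact this.measurable.comp (measurable_ereal_toReal.div_const 2)

lemma measurable_entFn : Measurable entFn := by
  unfold entFn
  refine Measurable.ite (measurableSet_singleton _) measurable_const ?_
  refine Measurable.ite (measurableSet_singleton _) measurable_const ?_
  unfold Real.logb
  have := measurable_ereal_toReal
  fun_prop

lemma measurable_wt : Measurable wt := by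
  unfold wt
  refine Measurable.ite (measurableSet_singleton _) measurable_const ?_
  refine Measurable.ite (measurableSet_singleton _) measurable_const ?_
  have := measurable_ereal_toReal
  fun_prop

lemma abs_tanhHalf_mem (α : EReal) : |tanhHalf α| ∈ Set.Icc (0 : ℝ) 1 := by
  refine ⟨abs_nonneg _, ?_⟩
  unfold tanhHalf
  split_ifs
  · simp
  · simp
  · exact (Real.abs_tanh_lt_one _).le

/-- The entropy as a function of `|tanh(α/2)|`. -/
def hEnt (t : ℝ) : ℝ := Real.binEntropy ((1 - t) / 2)

/-- The symmetrised entropy kernel. -/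
def symEnt (α : EReal) : ℝ := hEnt |tanhHalf α| / Real.log 2

lemma hEnt_abs (t : ℝ) : hEnt |t| = hEnt t := by
  rcases abs_choice t with h | h
  · rw [h]
  · rw [h]; unfold hEnt
    rw [← Real.binEntropy_one_sub]
    congr 1; ring

lemma continuous_hEnt : Continuous hEnt := by
  unfold hEnt
  exact Real.binEntropy_continuous.comp (by fun_prop)

lemma measurable_symEnt : Measurable symEnt := by
  unfold symEnt
  exact (continuous_hEnt.measurable.comp (measurable_tanhHalf.norm)).div_const _

lemma symEnt_nonneg (α : EReal) : 0 ≤ symEnt α := by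
  have h := abs_tanhHalf_mem α
  unfold symEnt hEnt
  refine div_nonneg (Real.binEntropy_nonneg ?_ ?_) (Real.log_nonneg (by norm_num))
  · linarith [h.2]
  · linarith [h.1]

lemma symEnt_le_one (α : EReal) : symEnt α ≤ 1 := by
  unfold symEnt hEnt
  rw [div_le_one (Real.log_pos (by norm_num))]
  exact Real.binEntropy_le_log_two

lemma entFn_nonneg (α : EReal) : 0 ≤ entFn α := by
  unfold entFn
  split_ifs
  · exact le_rfl
  · exact le_rfl
  · apply Real.logb_nonneg (by norm_num)
    linarith [Real.exp_pos (-α.toReal)]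

lemma two_lintegral {μ : Measure EReal} (hs : IsSymmMeasure μ) {φ : EReal → ℝ}
    (hm : Measurable φ) (h1 : φ ⊤ = 0) (h2 : φ ⊥ = 0) :
    2 * ∫⁻ α, ENNReal.ofReal (φ α) ∂μ =
      ∫⁻ α, (ENNReal.ofReal (Real.exp (α.toReal / 2) * φ α) +
        ENNReal.ofReal (Real.exp ((-α).toReal / 2) * φ (-α))) ∂(μ.withDensity wt) := by
  have hneg : Measurable (fun a : EReal => -a) := continuous_neg.measurable
  have hρ : (μ.withDensity wt).map (fun a : EReal => -a) = μ.withDensity wt := by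
    ext E hE
    rw [Measure.map_apply hneg hE, withDensity_apply _ (hneg hE), withDensity_apply _ hE]
    exact hs E hE
  have hT := measurable_ereal_toReal
  have hG : Measurable (fun α : EReal => ENNReal.ofReal (Real.exp (α.toReal / 2) * φ α)) := by
    fun_prop
  have e1 : ∫⁻ α, ENNReal.ofReal (φ α) ∂μ =
      ∫⁻ α, ENNReal.ofReal (Real.exp (α.toReal / 2) * φ α) ∂(μ.withDensity wt) := by
    rw [lintegral_withDensity_eq_lintegral_mul _ measurable_wt hG]
    apply lintegral_congr
    intro α
    induction α with
    | bot => simp [h2]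
    | top => simp [h1]
    | coe a =>
      simp only [Pi.mul_apply, wt, EReal.coe_ne_bot, EReal.coe_ne_top, if_false, EReal.toReal_coe]
      rw [← ENNReal.ofReal_mul (Real.exp_pos _).le, ← mul_assoc, ← Real.exp_add]
      congr 1
      have : -a / 2 + a / 2 = 0 := by ring
      rw [this]; simp
  have e2 : ∫⁻ α, ENNReal.ofReal (Real.exp ((-α).toReal / 2) * φ (-α)) ∂(μ.withDensity wt) =
      ∫⁻ α, ENNReal.ofReal (Real.exp (α.toReal / 2) * φ α) ∂(μ.withDensity wt) := by
    conv_rhs => rw [← hρ]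
    rw [lintegral_map hG hneg]
  rw [lintegral_add_left hG, e2, e1, two_mul]

lemma kernel_identity (a : ℝ) :
    Real.exp (a / 2) * entFn (a : EReal) + Real.exp (-a / 2) * entFn ((-a : ℝ) : EReal) =
    Real.exp (a / 2) * symEnt (a : EReal) + Real.exp (-a / 2) * symEnt ((-a : ℝ) : EReal) := by
  have hu := Real.exp_pos (a / 2)
  have hv := Real.exp_pos (-a / 2)
  set u := Real.exp (a / 2) with hud
  set v := Real.exp (-a / 2) with hvd
  have huv : u * v = 1 := by rw [hud, hvd, ← Real.exp_add]; ring_nf; simp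
  have hua : Real.exp a = u / v := by
    rw [hud, hvd, ← Real.exp_sub]; congr 1; ring
  have hva : Real.exp (-a) = v / u := by
    rw [hud, hvd, ← Real.exp_sub]; congr 1; ring
  have ht : tanhHalf (a : EReal) = (u - v) / (u + v) := by
    simp only [tanhHalf, EReal.coe_ne_bot, EReal.coe_ne_top, if_false, EReal.toReal_coe]
    rw [Real.tanh_eq, hud, hvd, neg_div]
  have ht' : tanhHalf ((-a : ℝ) : EReal) = -((u - v) / (u + v)) := by
    rw [← ht]
    simp only [tanhHalf, EReal.coe_ne_bot, EReal.coe_ne_top, if_false, EReal.toReal_coe]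
    rw [neg_div, Real.tanh_neg]
  have hsy : symEnt ((-a : ℝ) : EReal) = symEnt (a : EReal) := by
    unfold symEnt; rw [ht', ht, abs_neg]
  have hs : symEnt (a : EReal) =
      (v / (u + v) * Real.log (1 + u / v) + u / (u + v) * Real.log (1 + v / u)) / Real.log 2 := by
    unfold symEnt
    rw [hEnt_abs, ht]
    unfold hEnt Real.binEntropy
    have e1 : (1 - (u - v) / (u + v)) / 2 = v / (u + v) := by field_simp; ring
    have e2 : 1 - v / (u + v) = u / (u + v) := by field_simp; ring
    have e3 : (v / (u + v))⁻¹ = 1 + u / v := by field_simp; ring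
    have e4 : (u / (u + v))⁻¹ = 1 + v / u := by field_simp
    rw [e1, e2, e3, e4]
  rw [hsy, hs]
  simp only [entFn, EReal.coe_ne_bot, EReal.coe_ne_top, if_false, EReal.toReal_coe, neg_neg]
  rw [hua, hva, Real.logb, Real.logb]
  have hl : Real.log 2 ≠ 0 := (Real.log_pos (by norm_num)).ne'
  field_simp
  ring

lemma symEnt_top : symEnt ⊤ = 0 := by simp [symEnt, hEnt, tanhHalf]
lemma symEnt_bot : symEnt ⊥ = 0 := by simp [symEnt, hEnt, tanhHalf]

lemma lintegral_entFn {μ : Measure EReal} (hs : IsSymmMeasure μ) :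
    ∫⁻ α, ENNReal.ofReal (entFn α) ∂μ = ∫⁻ α, ENNReal.ofReal (symEnt α) ∂μ := by
  have h1 := two_lintegral hs measurable_entFn (by simp [entFn]) (by simp [entFn])
  have h2 := two_lintegral hs measurable_symEnt symEnt_top symEnt_bot
  have h3 : 2 * ∫⁻ α, ENNReal.ofReal (entFn α) ∂μ = 2 * ∫⁻ α, ENNReal.ofReal (symEnt α) ∂μ := by
    rw [h1, h2]
    apply lintegral_congr
    intro α
    have P : ∀ b : ℝ, 0 ≤ Real.exp b := fun b => (Real.exp_pos b).le
    rw [← ENNReal.ofReal_add (mul_nonneg (P _) (entFn_nonneg _))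
        (mul_nonneg (P _) (entFn_nonneg _)),
      ← ENNReal.ofReal_add (mul_nonneg (P _) (symEnt_nonneg _))
        (mul_nonneg (P _) (symEnt_nonneg _))]
    congr 1
    induction α with
    | bot => simp [symEnt_top, symEnt_bot, entFn]
    | top => simp [symEnt_top, symEnt_bot, entFn]
    | coe a =>
      have := kernel_identity a
      rw [← EReal.coe_neg]
      simpa only [EReal.toReal_coe] using this
  exact (ENNReal.mul_right_inj (by norm_num) (by norm_num)).1 h3

lemma H_eq {x : SM} (hx : MemX x) : H x = ∫ α, symEnt α ∂(jp x) := by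
  obtain ⟨-, h0, hs⟩ := jp_jn_of_memX hx
  unfold H sInt
  rw [h0, integral_zero_measure, sub_zero,
    integral_eq_lintegral_of_nonneg_ae (ae_of_all _ entFn_nonneg)
      measurable_entFn.aestronglyMeasurable,
    integral_eq_lintegral_of_nonneg_ae (ae_of_all _ symEnt_nonneg)
      measurable_symEnt.aestronglyMeasurable, lintegral_entFn hs]

lemma If_eq {x : SM} (hx : MemX x) (f : ℝ → ℝ) :
    If f x = ∫ α, f |tanhHalf α| ∂(jp x) := by
  obtain ⟨-, h0, -⟩ := jp_jn_of_memX hx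
  unfold If sInt
  rw [h0, integral_zero_measure, sub_zero]

lemma integrable_cont {μ : Measure EReal} [IsProbabilityMeasure μ] {f : ℝ → ℝ}
    (hf : Continuous f) : Integrable (fun α => f |tanhHalf α|) μ := by
  obtain ⟨C, hC⟩ := (isCompact_Icc (a := (0 : ℝ)) (b := 1)).exists_bound_of_continuousOn
    hf.continuousOn
  refine Integrable.of_bound
    (hf.measurable.comp measurable_tanhHalf.norm).aestronglyMeasurable C (ae_of_all _ fun α => ?_)
  exact hC _ (abs_tanhHalf_mem α)

lemma concave_perturb (l ε : ℝ) (hb : |ε| * Real.exp |l| * (2 * |l| + 4 * l ^ 2) ≤ 1) :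
    ConcaveOn ℝ (Set.Icc (-1 : ℝ) 1) (fun t => hEnt t + ε * Real.exp (l * t ^ 2)) := by
  refine concaveOn_of_hasDerivWithinAt2_nonpos (convex_Icc _ _)
    (f' := fun t => (Real.log ((1 - t) / 2) - Real.log ((1 + t) / 2)) / 2
      + ε * (Real.exp (l * t ^ 2) * (2 * l * t)))
    (f'' := fun t => (-1 / (1 - t) - 1 / (1 + t)) / 2
      + ε * (Real.exp (l * t ^ 2) * (2 * l + 4 * l ^ 2 * t ^ 2)))
    ?_ ?_ ?_ ?_
  · have := continuous_hEnt
    fun_prop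
  · intro t ht
    rw [interior_Icc] at ht
    have ht1 : (1 - t) / 2 ≠ 0 := by have := ht.2; intro h; linarith
    have ht2 : (1 - t) / 2 ≠ 1 := by have := ht.1; intro h; linarith
    have hin : HasDerivAt (fun t : ℝ => (1 - t) / 2) (-1 / 2) t :=
      ((hasDerivAt_id t).const_sub 1).div_const 2
    have hA := (Real.hasDerivAt_binEntropy ht1 ht2).comp t hin
    have hq : HasDerivAt (fun t : ℝ => l * t ^ 2) (2 * l * t) t := by
      have := (hasDerivAt_pow 2 t).const_mul l
      refine this.congr_deriv ?_
      push_cast; ring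
    have hB := (hq.exp).const_mul ε
    have := hA.add hB
    have e : 1 - (1 - t) / 2 = (1 + t) / 2 := by ring
    rw [e] at this
    refine HasDerivAt.hasDerivWithinAt ?_
    refine HasDerivAt.congr_deriv (f := fun t => hEnt t + ε * Real.exp (l * t ^ 2)) this ?_
    ring
  · intro t ht
    rw [interior_Icc] at ht
    have ht1 : (1 - t) / 2 ≠ 0 := by have := ht.2; intro h; linarith
    have ht2 : (1 + t) / 2 ≠ 0 := by have := ht.1; intro h; linarith
    have hin : HasDerivAt (fun t : ℝ => (1 - t) / 2) (-1 / 2) t :=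
      ((hasDerivAt_id t).const_sub 1).div_const 2
    have hin' : HasDerivAt (fun t : ℝ => (1 + t) / 2) (1 / 2) t :=
      ((hasDerivAt_id t).const_add 1).div_const 2
    have hA := ((hin.log ht1).sub (hin'.log ht2)).div_const 2
    have hq : HasDerivAt (fun t : ℝ => l * t ^ 2) (2 * l * t) t := by
      have := (hasDerivAt_pow 2 t).const_mul l
      refine this.congr_deriv ?_
      push_cast; ring
    have hlin : HasDerivAt (fun t : ℝ => 2 * l * t) (2 * l) t := by
      simpa using (hasDerivAt_id t).const_mul (2 * l)
    have hB := ((hq.exp).mul hlin).const_mul ε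
    have := hA.add hB
    refine HasDerivAt.hasDerivWithinAt ?_
    refine HasDerivAt.congr_deriv
      (f := fun t => (Real.log ((1 - t) / 2) - Real.log ((1 + t) / 2)) / 2
        + ε * (Real.exp (l * t ^ 2) * (2 * l * t))) this ?_
    have h1 : 1 - t ≠ 0 := by have := ht.2; intro h; linarith
    have h2 : 1 + t ≠ 0 := by have := ht.1; intro h; linarith
    field_simp
    ring
  · intro t ht
    rw [interior_Icc] at ht
    have h1 : 0 < 1 - t := by linarith [ht.2]
    have h2 : 0 < 1 + t := by linarith [ht.1]
    have ht2 : t ^ 2 ≤ 1 := by nlinarith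
    have hA : (-1 / (1 - t) - 1 / (1 + t)) / 2 ≤ -1 := by
      have : (-1 / (1 - t) - 1 / (1 + t)) / 2 = -(1 / ((1 - t) * (1 + t))) := by
        field_simp; ring
      rw [this]
      apply neg_le_neg
      rw [le_div_iff₀ (by positivity)]
      nlinarith
    have hB : ε * (Real.exp (l * t ^ 2) * (2 * l + 4 * l ^ 2 * t ^ 2)) ≤ 1 := by
      refine le_trans (le_abs_self _) (le_trans ?_ hb)
      rw [abs_mul, abs_mul, abs_of_pos (Real.exp_pos _), mul_assoc |ε|]
      have hl : l * t ^ 2 ≤ |l| := by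
        calc l * t ^ 2 ≤ |l| * t ^ 2 := by gcongr; exact le_abs_self l
          _ ≤ |l| * 1 := by gcongr
          _ = |l| := mul_one _
      have hp : |2 * l + 4 * l ^ 2 * t ^ 2| ≤ 2 * |l| + 4 * l ^ 2 := by
        refine (abs_add_le _ _).trans ?_
        rw [abs_mul, abs_of_nonneg (by positivity : 0 ≤ 4 * l ^ 2 * t ^ 2),
          abs_of_pos (by norm_num : (0 : ℝ) < 2)]
        nlinarith [sq_nonneg l]
      gcongr
    linarith

lemma antitone_of_even {k : ℝ → ℝ} (hk : ConcaveOn ℝ (Set.Icc (-1 : ℝ) 1) k)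
    (he : ∀ t, k (-t) = k t) : AntitoneOn k (Set.Icc (0 : ℝ) 1) := by
  intro s hs t ht hst
  rcases ht.1.eq_or_lt with h0 | h0
  · have : s = t := le_antisymm hst (by rw [← h0]; exact hs.1)
    rw [this]
  · have hs0 := hs.1
    have ht1 := ht.2
    have := hk.2 (show -t ∈ Set.Icc (-1 : ℝ) 1 from ⟨by linarith, by linarith⟩)
      (show t ∈ Set.Icc (-1 : ℝ) 1 from ⟨by linarith, ht1⟩)
      (show 0 ≤ (t - s) / (2 * t) from div_nonneg (by linarith) (by linarith))
      (show 0 ≤ (t + s) / (2 * t) from div_nonneg (by linarith) (by linarith))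
      (by field_simp; ring)
    simp only [smul_eq_mul, he] at this
    have e1 : (t - s) / (2 * t) * -t + (t + s) / (2 * t) * t = s := by field_simp; ring
    have e2 : (t - s) / (2 * t) * k t + (t + s) / (2 * t) * k t = k t := by field_simp; ring
    rw [e1, e2] at this
    exact this

lemma degraded_exp {x1 x2 : SM} (h1 : MemX x1) (h2 : MemX x2) (hd : Degraded x1 x2)
    (l ε : ℝ) (hb : |ε| * Real.exp |l| * (2 * |l| + 4 * l ^ 2) ≤ 1) :
    Real.log 2 * H x2 + ε * ∫ α, Real.exp (l * |tanhHalf α| ^ 2) ∂(jp x2) ≤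
    Real.log 2 * H x1 + ε * ∫ α, Real.exp (l * |tanhHalf α| ^ 2) ∂(jp x1) := by
  have hc := concave_perturb l ε hb
  have ha := antitone_of_even hc (fun t => by
    rw [← hEnt_abs (-t), abs_neg, hEnt_abs, neg_sq])
  have hc' := hc.subset (Set.Icc_subset_Icc (by norm_num : (-1 : ℝ) ≤ 0) le_rfl) (convex_Icc 0 1)
  have key := hd _ hc' ha
  have hl : Real.log 2 ≠ 0 := (Real.log_pos (by norm_num)).ne'
  have split : ∀ x : SM, MemX x → If (fun t => hEnt t + ε * Real.exp (l * t ^ 2)) x =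
      Real.log 2 * H x + ε * ∫ α, Real.exp (l * |tanhHalf α| ^ 2) ∂(jp x) := by
    intro x hx
    have := (jp_jn_of_memX hx).1
    rw [If_eq hx, H_eq hx, ← integral_const_mul, ← integral_const_mul, ← integral_add]
    · congr 1
      ext α
      simp only [symEnt]
      field_simp
    · have := (integrable_cont (μ := jp x) continuous_hEnt)
      refine this.congr (ae_of_all _ fun α => ?_)
      simp only [symEnt]
      field_simp
    · exact integrable_cont (μ := jp x) (f := fun t => ε * Real.exp (l * t ^ 2)) (by fun_prop)
  rwa [split x2 h2, split x1 h1] at key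

lemma law_eq {x1 x2 : SM} (h1 : MemX x1) (h2 : MemX x2) (hd : Degraded x1 x2)
    (hH : H x1 ≤ H x2) :
    (jp x1).map (fun α => |tanhHalf α| ^ 2) = (jp x2).map (fun α => |tanhHalf α| ^ 2) := by
  have i1 := (jp_jn_of_memX h1).1
  have i2 := (jp_jn_of_memX h2).1
  have hl : 0 < Real.log 2 := Real.log_pos (by norm_num)
  have hm : ProbabilityTheory.mgf (fun α => |tanhHalf α| ^ 2) (jp x1) =
      ProbabilityTheory.mgf (fun α => |tanhHalf α| ^ 2) (jp x2) := by
    ext l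
    unfold ProbabilityTheory.mgf
    set B := Real.exp |l| * (2 * |l| + 4 * l ^ 2) with hB
    have hB0 : 0 ≤ B := by positivity
    have he : 0 < 1 / (B + 1) := by positivity
    have hle : |1 / (B + 1)| * Real.exp |l| * (2 * |l| + 4 * l ^ 2) ≤ 1 := by
      rw [abs_of_pos he, mul_assoc, ← hB, div_mul_eq_mul_div, div_le_one (by positivity)]
      linarith
    have k1 := degraded_exp h1 h2 hd l (1 / (B + 1)) hle
    have k2 := degraded_exp h1 h2 hd l (-(1 / (B + 1))) (by rwa [abs_neg])
    have hH' := mul_le_mul_of_nonneg_left hH hl.le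
    apply le_antisymm
    · refine le_of_mul_le_mul_left ?_ he
      linarith
    · refine le_of_mul_le_mul_left ?_ he
      linarith
  have hu : ProbabilityTheory.integrableExpSet (fun α => |tanhHalf α| ^ 2) (jp x1) = Set.univ := by
    ext l
    simp only [Set.mem_univ, iff_true]
    exact integrable_cont (μ := jp x1) (f := fun t => Real.exp (l * t ^ 2)) (by fun_prop)
  have hmeas : Measurable (fun α => |tanhHalf α| ^ 2) := (measurable_tanhHalf.norm).pow_const 2
  refine Measure.ext_of_complexMGF_eq hmeas.aemeasurable hmeas.aemeasurable ?_
  ext z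
  exact ProbabilityTheory.eqOn_complexMGF_of_mgf hm (by rw [hu]; simp)

lemma If_eq_law {x : SM} (hx : MemX x) {f : ℝ → ℝ} (hf : AntitoneOn f (Set.Icc (0 : ℝ) 1)) :
    If f x = ∫ s, f (Set.projIcc (0 : ℝ) 1 zero_le_one (Real.sqrt s))
      ∂((jp x).map (fun α => |tanhHalf α| ^ 2)) := by
  have hg : Antitone (fun s => f (Set.projIcc (0 : ℝ) 1 zero_le_one (Real.sqrt s))) := by
    intro s t hst
    refine hf (Subtype.coe_prop _) (Subtype.coe_prop _) ?_
    exact Set.monotone_projIcc _ (Real.sqrt_le_sqrt hst)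
  have hmeas : Measurable (fun α => |tanhHalf α| ^ 2) := (measurable_tanhHalf.norm).pow_const 2
  rw [integral_map hmeas.aemeasurable hg.measurable.aestronglyMeasurable, If_eq hx]
  congr 1
  ext α
  rw [Real.sqrt_sq (abs_nonneg _), Set.projIcc_of_mem _ (abs_tanhHalf_mem α)]

/-- The entropy functional is monotone with respect to degradation
(`x1 ≻ x2` implies `H(x1) > H(x2)`) and satisfies `0 ≤ H(x) ≤ 1` on symmetric
probability measures. -/
theorem entropy_monotone_and_bounded :
    (∀ x1 x2 : SM, MemX x1 → MemX x2 → StrictlyDegraded x1 x2 → H x2 < H x1) ∧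
    (∀ x : SM, MemX x → 0 ≤ H x ∧ H x ≤ 1) := by
  refine ⟨?_, ?_⟩
  · rintro x1 x2 h1 h2 ⟨hd, f, -, hf, hlt⟩
    by_contra hcon
    have hl := law_eq h1 h2 hd (not_lt.1 hcon)
    rw [If_eq_law h1 hf, If_eq_law h2 hf, hl] at hlt
    exact lt_irrefl _ hlt
  · intro x hx
    have := (jp_jn_of_memX hx).1
    rw [H_eq hx]
    refine ⟨integral_nonneg symEnt_nonneg, ?_⟩
    have hi : Integrable symEnt (jp x) :=
      Integrable.of_bound measurable_symEnt.aestronglyMeasurable 1 (ae_of_all _ fun α => by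
        rw [Real.norm_eq_abs, abs_of_nonneg (symEnt_nonneg α)]; exact symEnt_le_one α)
    calc ∫ α, symEnt α ∂(jp x) ≤ ∫ _, (1 : ℝ) ∂(jp x) :=
          integral_mono hi (integrable_const _) symEnt_le_one
      _ = 1 := by simp

end SCLDPC
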